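/- arXiv:2601.03695 — 3 statements merged into one kernel-verified Lean document; each statement's English description precedes it below -/
import Mathlib

section
/- Let 1 < p < q < ∞ and suppose α/n ≥ β/m and (α+ρβ)/(n+ρm) = 1/p − 1/q. Then there exists a constant C, depending only on n, m, α, β, ρ, p, q, such that for every nonnegative measurable function f on ℝ^n × ℝ^m one has ‖I f‖_{L^q(ℝ^{n+m})} ≤ C·‖f‖_{L^p(ℝ^{n+m})}. -/
open MeasureTheory

/-- The flag kernel `Ω(x,y) = |x|^(α-n) (|x|^ρ + |y|)^(β-m)` on `ℝ^n × ℝ^m`. -/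
noncomputable def flagKernel (n m : ℕ) (α β ρ : ℝ)
    (x : EuclideanSpace ℝ (Fin n)) (y : EuclideanSpace ℝ (Fin m)) : ℝ :=
  ‖x‖ ^ (α - (n : ℝ)) * (‖x‖ ^ ρ + ‖y‖) ^ (β - (m : ℝ))

/-- The fractional integral operator `I f(x,y) = ∬ f(u,v) Ω(x-u, y-v) du dv`. -/
noncomputable def flagOp (n m : ℕ) (α β ρ : ℝ)
    (f : EuclideanSpace ℝ (Fin n) × EuclideanSpace ℝ (Fin m) → ℝ)
    (z : EuclideanSpace ℝ (Fin n) × EuclideanSpace ℝ (Fin m)) : ℝ :=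
  ∫ w : EuclideanSpace ℝ (Fin n) × EuclideanSpace ℝ (Fin m),
    f w * flagKernel n m α β ρ (z.1 - w.1) (z.2 - w.2)

open Module Set Metric ENNReal

section
variable {E : Type*} [NormedAddCommGroup E] [NormedSpace ℝ E] [FiniteDimensional ℝ E]
  [MeasurableSpace E] [BorelSpace E] (μ : Measure E) [μ.IsAddHaarMeasure]

theorem setLIntegral_enorm_rpow_preimage_smul {S : Set E} (hS : MeasurableSet S) (a : ℝ) {R : ℝ}
    (hR : 0 < R) :
    ∫⁻ x in S, ‖x‖ₑ ^ (-a) ∂μ =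
      ENNReal.ofReal (R ^ ((finrank ℝ E : ℝ) - a)) * ∫⁻ x in (R • ·) ⁻¹' S, ‖x‖ₑ ^ (-a) ∂μ := by
  have hmeas : Measurable fun x : E => R • x := measurable_const_smul R
  have h1 : ∫⁻ x in (R • ·) ⁻¹' S, ‖R • x‖ₑ ^ (-a) ∂μ =
      ENNReal.ofReal (R ^ (-(finrank ℝ E : ℝ))) * ∫⁻ x in S, ‖x‖ₑ ^ (-a) ∂μ := by
    rw [← setLIntegral_map (f := fun x : E => ‖x‖ₑ ^ (-a)) hS (by fun_prop) hmeas,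
      Measure.map_addHaar_smul μ hR.ne', Measure.restrict_smul, lintegral_smul_measure,
      abs_of_pos (by positivity), Real.rpow_neg hR.le, Real.rpow_natCast, smul_eq_mul]
  have h2 : ∀ x : E, ‖R • x‖ₑ ^ (-a) = ENNReal.ofReal (R ^ (-a)) * ‖x‖ₑ ^ (-a) := by
    intro x
    have hR' : ‖R‖ₑ = ENNReal.ofReal R := Real.enorm_of_nonneg hR.le
    rw [enorm_smul, hR', ← ENNReal.ofReal_rpow_of_pos hR]
    simp [ENNReal.mul_rpow_eq_ite]
  simp_rw [h2] at h1
  rw [lintegral_const_mul' _ _ ENNReal.ofReal_ne_top] at h1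
  calc ∫⁻ x in S, ‖x‖ₑ ^ (-a) ∂μ
      = ENNReal.ofReal (R ^ (finrank ℝ E : ℝ)) *
          (ENNReal.ofReal (R ^ (-(finrank ℝ E : ℝ))) * ∫⁻ x in S, ‖x‖ₑ ^ (-a) ∂μ) := by
        rw [← mul_assoc, ← ENNReal.ofReal_mul (by positivity), ← Real.rpow_add hR]
        simp
    _ = _ := by
        rw [← h1, ← mul_assoc, ← ENNReal.ofReal_mul (by positivity), ← Real.rpow_add hR,
          sub_eq_add_neg]

theorem enorm_rpow_ae_eq [Nontrivial E] (a : ℝ) :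
    (fun x : E => ‖x‖ₑ ^ (-a)) =ᵐ[μ] fun x => ‖‖x‖ ^ (-a)‖ₑ := by
  filter_upwards [Measure.ae_ne μ 0] with x hx
  have : 0 < ‖x‖ := norm_pos_iff.2 hx
  rw [Real.enorm_of_nonneg (by positivity), ← ENNReal.ofReal_rpow_of_pos this, ofReal_norm]

theorem setLIntegral_ball_enorm_rpow_lt_top [Nontrivial E] {a : ℝ} (ha : a < finrank ℝ E) :
    ∫⁻ x in ball (0 : E) 1, ‖x‖ₑ ^ (-a) ∂μ < ⊤ := by
  rw [lintegral_congr_ae (ae_restrict_of_ae (enorm_rpow_ae_eq μ a))]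
  refine Integrable.hasFiniteIntegral (?_ : IntegrableOn _ _ _)
  rw [integrableOn_fun_norm_addHaar μ (f := fun t => t ^ (-a))]
  have : IntegrableOn (fun t : ℝ => t ^ ((finrank ℝ E : ℝ) - 1 - a)) (Ioo 0 1) := by
    rw [intervalIntegral.integrableOn_Ioo_rpow_iff one_pos]; linarith
  refine this.congr_fun (fun t ht => ?_) measurableSet_Ioo
  have h1 : 1 ≤ finrank ℝ E := finrank_pos
  simp only [smul_eq_mul]
  rw [← Real.rpow_natCast, ← Real.rpow_add ht.1, Nat.cast_sub h1]
  simp [sub_eq_add_neg]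

theorem setLIntegral_compl_ball_enorm_rpow_lt_top [Nontrivial E] {a : ℝ}
    (ha : (finrank ℝ E : ℝ) < a) :
    ∫⁻ x in (ball (0 : E) 1)ᶜ, ‖x‖ₑ ^ (-a) ∂μ < ⊤ := by
  have hint : Integrable (fun x : E => (1 + ‖x‖) ^ (-a)) μ := integrable_one_add_norm ha
  have ha0 : 0 < a := lt_of_le_of_lt (Nat.cast_nonneg _) ha
  calc ∫⁻ x in (ball (0 : E) 1)ᶜ, ‖x‖ₑ ^ (-a) ∂μ
      ≤ ∫⁻ x in (ball (0 : E) 1)ᶜ, ENNReal.ofReal (2 ^ a) * ‖(1 + ‖x‖) ^ (-a)‖ₑ ∂μ := by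
        refine setLIntegral_mono' measurableSet_ball.compl fun x hx => ?_
        have hx1 : 1 ≤ ‖x‖ := by simpa using hx
        have hx0 : 0 < ‖x‖ := by linarith
        rw [Real.enorm_of_nonneg (by positivity), ← ENNReal.ofReal_mul (by positivity),
          ← ofReal_norm, ENNReal.ofReal_rpow_of_pos hx0]
        refine ENNReal.ofReal_le_ofReal ?_
        have : (2 * ‖x‖) ^ (-a) ≤ (1 + ‖x‖) ^ (-a) :=
          Real.rpow_le_rpow_of_nonpos (by positivity) (by linarith) (by linarith)
        rw [Real.mul_rpow (by norm_num) hx0.le, Real.rpow_neg (by norm_num)] at this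
        rwa [inv_mul_le_iff₀ (by positivity)] at this
    _ ≤ ∫⁻ x, ENNReal.ofReal (2 ^ a) * ‖(1 + ‖x‖) ^ (-a)‖ₑ ∂μ := setLIntegral_le_lintegral _ _
    _ < ⊤ := by
        rw [lintegral_const_mul' _ _ ENNReal.ofReal_ne_top]
        exact ENNReal.mul_lt_top ENNReal.ofReal_lt_top hint.hasFiniteIntegral
/-- The near-far decomposition behind the Hardy-Littlewood-Sobolev inequality. The near part uses
the pointwise bound on `h`, the far part uses Hölder's inequality. -/
theorem exists_setLIntegral_riesz_le [Nontrivial E] {p r : ℝ} (hp : 1 < p) (hr : 1 < r)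
    (hpr : 1 < 1 / p + 1 / r) :
    ∃ C : ℝ≥0∞, C ≠ ⊤ ∧ ∀ h : E → ℝ≥0∞, Measurable h → ∫⁻ y, h y ^ r ∂μ ≤ 1 →
      ∀ (a : ℝ≥0∞) (x : E), ∫⁻ y in {y | h y ^ r ≤ a ^ p},
        a * (‖x - y‖ₑ ^ (-((finrank ℝ E : ℝ) * (2 - 1 / p - 1 / r))) * h y) ∂μ ≤ C * a ^ p := by
  set d : ℝ := (finrank ℝ E : ℝ) with hd
  have hd0 : 0 < d := by rw [hd]; exact_mod_cast finrank_pos (R := ℝ) (M := E)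
  set l : ℝ := d * (2 - 1 / p - 1 / r) with hl
  have hp0 : 0 < p := by linarith
  have hr0 : 0 < r := by linarith
  have hqr : r.HolderConjugate (r / (r - 1)) := Real.HolderConjugate.conjExponent hr
  set q : ℝ := r / (r - 1) with hq
  have hq0 : 0 < q := hqr.symm.pos
  have hqi : 1 / q = 1 - 1 / r := by rw [hq]; field_simp
  have hld : l < d := by rw [hl]; nlinarith
  have hlq : d < l * q := by
    have h1 : 1 / q < 2 - 1 / p - 1 / r := by
      rw [hqi]
      have : 1 / p < 1 := by rw [div_lt_one hp0]; exact hp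
      linarith
    rw [div_lt_iff₀ hq0] at h1
    rw [hl]; nlinarith
  have hc1 := setLIntegral_ball_enorm_rpow_lt_top μ hld
  have hc2 := setLIntegral_compl_ball_enorm_rpow_lt_top μ hlq
  set c1 := ∫⁻ x in ball (0 : E) 1, ‖x‖ₑ ^ (-l) ∂μ with hc1d
  set c2 := ∫⁻ x in (ball (0 : E) 1)ᶜ, ‖x‖ₑ ^ (-(l * q)) ∂μ with hc2d
  have hc2' : c2 ^ (1 / q) ≠ ⊤ := ENNReal.rpow_ne_top_of_nonneg (by positivity) hc2.ne
  refine ⟨1 + (c1 + c2 ^ (1 / q)), by finiteness, fun h hh hh1 a x => ?_⟩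
  rcases eq_or_ne a 0 with rfl | ha0
  · simp
  rcases eq_or_ne a ⊤ with rfl | hat
  · rw [ENNReal.top_rpow_of_pos hp0, ENNReal.mul_top (by simp)]; exact le_top
  obtain ⟨A, hA, rfl⟩ : ∃ A : ℝ, 0 < A ∧ a = ENNReal.ofReal A :=
    ⟨a.toReal, ENNReal.toReal_pos ha0 hat, (ENNReal.ofReal_toReal hat).symm⟩
  set R : ℝ := A ^ (-p / d) with hR
  have hR0 : 0 < R := by positivity
  have hpre : (R • · : E → E) ⁻¹' ball 0 R = ball 0 1 := by
    ext z
    simp [norm_smul, abs_of_pos hR0, hR0]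
  have hprec : (R • · : E → E) ⁻¹' (ball 0 R)ᶜ = (ball 0 1)ᶜ := by rw [preimage_compl, hpre]
  have htrans : ∀ (S : Set E), MeasurableSet S → ∀ b : ℝ,
      ∫⁻ y in {y | x - y ∈ S}, ‖x - y‖ₑ ^ (-b) ∂μ = ∫⁻ y in S, ‖y‖ₑ ^ (-b) ∂μ := by
    intro S hS b
    have hxS : MeasurableSet {y | x - y ∈ S} := hS.preimage (by fun_prop)
    rw [← lintegral_indicator hS,
      ← lintegral_sub_left_eq_self (S.indicator fun y : E => ‖y‖ₑ ^ (-b)) x,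
      ← lintegral_indicator hxS]
    rfl
  set S1 : Set E := {y | x - y ∈ ball 0 R} with hS1
  set S2 : Set E := {y | x - y ∈ (ball 0 R)ᶜ} with hS2
  have hnear : ∫⁻ y in {y | h y ^ r ≤ ENNReal.ofReal A ^ p} ∩ S1,
      ENNReal.ofReal A * (‖x - y‖ₑ ^ (-l) * h y) ∂μ ≤ c1 * ENNReal.ofReal A ^ p := by
    have hset : MeasurableSet S1 := measurableSet_ball.preimage (by fun_prop)
    have hset' : MeasurableSet ({y | h y ^ r ≤ ENNReal.ofReal A ^ p} ∩ S1) :=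
      (measurableSet_le (by fun_prop) measurable_const).inter hset
    calc _ ≤ ∫⁻ y in {y | h y ^ r ≤ ENNReal.ofReal A ^ p} ∩ S1,
          (ENNReal.ofReal A * ENNReal.ofReal (A ^ (p / r))) * ‖x - y‖ₑ ^ (-l) ∂μ := by
          refine setLIntegral_mono' hset' fun y hy => ?_
          have hy1 : h y ≤ ENNReal.ofReal (A ^ (p / r)) := by
            have := ENNReal.rpow_le_rpow hy.1 (z := r⁻¹) (by positivity)
            rwa [ENNReal.rpow_rpow_inv hr0.ne', ← ENNReal.rpow_mul, ← div_eq_mul_inv,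
              ENNReal.ofReal_rpow_of_pos hA] at this
          rw [mul_assoc, mul_comm (‖x - y‖ₑ ^ (-l))]
          gcongr
      _ ≤ ∫⁻ y in S1,
          (ENNReal.ofReal A * ENNReal.ofReal (A ^ (p / r))) * ‖x - y‖ₑ ^ (-l) ∂μ :=
          lintegral_mono_set inter_subset_right
      _ = c1 * ENNReal.ofReal A ^ p := by
          rw [lintegral_const_mul' _ _ (by finiteness), htrans _ measurableSet_ball,
            setLIntegral_enorm_rpow_preimage_smul μ measurableSet_ball _ hR0, hpre, ← hc1d,
            ← mul_assoc, mul_comm _ c1, ENNReal.ofReal_rpow_of_pos hA,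
            ← ENNReal.ofReal_mul (by positivity), ← ENNReal.ofReal_mul (by positivity), hR,
            ← Real.rpow_mul hA.le]
          congr 2
          nth_rewrite 1 [← Real.rpow_one A]
          rw [← Real.rpow_add hA, ← Real.rpow_add hA, ← hd, hl]
          congr 1
          field_simp
          ring
  have hfar : ∫⁻ y in {y | h y ^ r ≤ ENNReal.ofReal A ^ p} ∩ S2,
      ENNReal.ofReal A * (‖x - y‖ₑ ^ (-l) * h y) ∂μ ≤ c2 ^ (1 / q) * ENNReal.ofReal A ^ p := by
    have hset : MeasurableSet (ball (0 : E) R)ᶜ := measurableSet_ball.compl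
    calc _ ≤ ∫⁻ y in S2, ENNReal.ofReal A * (‖x - y‖ₑ ^ (-l) * h y) ∂μ :=
          lintegral_mono_set inter_subset_right
      _ = ENNReal.ofReal A * ∫⁻ y in S2, ((fun y => ‖x - y‖ₑ ^ (-l)) * h) y ∂μ :=
          lintegral_const_mul' _ _ ENNReal.ofReal_ne_top
      _ ≤ ENNReal.ofReal A * ((∫⁻ y in S2, (‖x - y‖ₑ ^ (-l)) ^ q ∂μ) ^ (1 / q) *
            (∫⁻ y in S2, h y ^ r ∂μ) ^ (1 / r)) := by
          gcongr
          exact ENNReal.lintegral_mul_le_Lp_mul_Lq _ hqr.symm (by fun_prop) hh.aemeasurable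
      _ ≤ ENNReal.ofReal A * ((∫⁻ y in S2, (‖x - y‖ₑ ^ (-l)) ^ q ∂μ) ^ (1 / q) * 1) := by
          gcongr
          refine ENNReal.rpow_le_one ?_ (by positivity)
          exact (setLIntegral_le_lintegral _ _).trans hh1
      _ = c2 ^ (1 / q) * ENNReal.ofReal A ^ p := by
          simp_rw [← ENNReal.rpow_mul, neg_mul]
          rw [mul_one, htrans _ hset, setLIntegral_enorm_rpow_preimage_smul μ hset _ hR0, hprec,
            ← hc2d, ENNReal.mul_rpow_of_nonneg _ _ (by positivity : 0 ≤ 1 / q), ← mul_assoc,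
            mul_comm _ (c2 ^ (1 / q)), ENNReal.ofReal_rpow_of_pos (by positivity),
            ENNReal.ofReal_rpow_of_pos hA, ← ENNReal.ofReal_mul (by positivity), hR,
            ← Real.rpow_mul hA.le, ← Real.rpow_mul hA.le]
          congr 2
          nth_rewrite 1 [← Real.rpow_one A]
          rw [← Real.rpow_add hA, ← hd]
          congr 1
          have : -p / d * (d - l * q) * (1 / q) = -p / d * (d * (1 / q) - l) := by
            field_simp
          rw [this, hqi, hl]
          field_simp
          ring
  have hun : {y | h y ^ r ≤ ENNReal.ofReal A ^ p} =
      ({y | h y ^ r ≤ ENNReal.ofReal A ^ p} ∩ S1) ∪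
        ({y | h y ^ r ≤ ENNReal.ofReal A ^ p} ∩ S2) := by
    ext y
    simp only [hS1, hS2, mem_union, mem_inter_iff, mem_ofPred_eq, mem_compl_iff]
    tauto
  rw [hun]
  refine (lintegral_union_le _ _ _).trans ((add_le_add hnear hfar).trans ?_)
  rw [← add_mul]
  exact mul_le_mul' le_add_self le_rfl

/-- The normalised bilinear Hardy-Littlewood-Sobolev inequality: split according to which of
`f x ^ p` and `h y ^ r` is larger. -/
theorem exists_lintegral_riesz_le_of_le_one [Nontrivial E] {p r : ℝ} (hp : 1 < p) (hr : 1 < r)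
    (hpr : 1 < 1 / p + 1 / r) :
    ∃ C : ℝ≥0∞, C ≠ ⊤ ∧ ∀ f h : E → ℝ≥0∞, Measurable f → Measurable h →
      ∫⁻ x, f x ^ p ∂μ ≤ 1 → ∫⁻ y, h y ^ r ∂μ ≤ 1 →
      ∫⁻ x, ∫⁻ y, f x * (‖x - y‖ₑ ^ (-((finrank ℝ E : ℝ) * (2 - 1 / p - 1 / r))) * h y) ∂μ ∂μ
        ≤ C := by
  obtain ⟨C₁, hC₁, H₁⟩ := exists_setLIntegral_riesz_le μ hp hr hpr
  obtain ⟨C₂, hC₂, H₂⟩ := exists_setLIntegral_riesz_le μ hr hp (by linarith)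
  refine ⟨C₁ + C₂, by finiteness, fun f h hf hh hf1 hh1 => ?_⟩
  rw [show (2 : ℝ) - 1 / r - 1 / p = 2 - 1 / p - 1 / r by ring] at H₂
  set l : ℝ := (finrank ℝ E : ℝ) * (2 - 1 / p - 1 / r) with hl
  set K : E × E → ℝ≥0∞ := fun z => f z.1 * (‖z.1 - z.2‖ₑ ^ (-l) * h z.2) with hK
  have hKm : Measurable K := by fun_prop
  set S : Set (E × E) := {z | h z.2 ^ r ≤ f z.1 ^ p} with hS
  have hSm : MeasurableSet S := measurableSet_le (by fun_prop) (by fun_prop)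
  have hle : ∀ z, K z ≤ S.indicator K z +
      (Prod.swap ⁻¹' {z | f z.2 ^ p ≤ h z.1 ^ r}).indicator K z := by
    intro z
    rcases le_total (h z.2 ^ r) (f z.1 ^ p) with hz | hz
    · rw [indicator_of_mem (show z ∈ S from hz)]; exact le_self_add
    · rw [indicator_of_mem (show z ∈ Prod.swap ⁻¹' {z | f z.2 ^ p ≤ h z.1 ^ r} from hz)]
      exact le_add_self
  have hTm : MeasurableSet (Prod.swap ⁻¹' {z : E × E | f z.2 ^ p ≤ h z.1 ^ r}) :=
    (measurableSet_le (by fun_prop) (by fun_prop)).preimage measurable_swap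
  calc ∫⁻ x, ∫⁻ y, f x * (‖x - y‖ₑ ^ (-l) * h y) ∂μ ∂μ
      = ∫⁻ z, K z ∂(μ.prod μ) := (lintegral_prod K hKm.aemeasurable).symm
    _ ≤ ∫⁻ z, (S.indicator K z +
          (Prod.swap ⁻¹' {z | f z.2 ^ p ≤ h z.1 ^ r}).indicator K z) ∂(μ.prod μ) :=
        lintegral_mono hle
    _ = ∫⁻ x, ∫⁻ y, S.indicator K (x, y) ∂μ ∂μ + ∫⁻ y, ∫⁻ x,
          (Prod.swap ⁻¹' {z | f z.2 ^ p ≤ h z.1 ^ r}).indicator K (x, y) ∂μ ∂μ := by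
        rw [lintegral_add_left (hKm.indicator hSm),
          lintegral_prod _ (hKm.indicator hSm).aemeasurable,
          lintegral_prod_symm _ (hKm.indicator hTm).aemeasurable]
    _ ≤ ∫⁻ x, C₁ * f x ^ p ∂μ + ∫⁻ y, C₂ * h y ^ r ∂μ := by
        refine add_le_add (lintegral_mono fun x => ?_) (lintegral_mono fun y => ?_)
        · refine le_trans (le_of_eq ?_) (H₁ h hh hh1 (f x) x)
          rw [← lintegral_indicator (measurableSet_le (by fun_prop) measurable_const)]
          rfl
        · refine le_trans (le_of_eq ?_) (H₂ f hf hf1 (h y) y)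
          rw [← lintegral_indicator (measurableSet_le (by fun_prop) measurable_const)]
          refine lintegral_congr fun x => ?_
          simp only [indicator, hK, mem_preimage, mem_ofPred_eq, Prod.swap]
          split_ifs
          · rw [← enorm_neg, neg_sub]; ring
          · rfl
    _ ≤ C₁ * 1 + C₂ * 1 := by
        rw [lintegral_const_mul' _ _ hC₁, lintegral_const_mul' _ _ hC₂]
        gcongr
    _ = C₁ + C₂ := by simp

/-- The Hardy-Littlewood-Sobolev inequality in bilinear form. -/
theorem exists_lintegral_riesz_le [Nontrivial E] {p r : ℝ} (hp : 1 < p) (hr : 1 < r)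
    (hpr : 1 < 1 / p + 1 / r) :
    ∃ C : ℝ≥0∞, C ≠ ⊤ ∧ ∀ f h : E → ℝ≥0∞, Measurable f → Measurable h →
      ∫⁻ x, ∫⁻ y, f x * (‖x - y‖ₑ ^ (-((finrank ℝ E : ℝ) * (2 - 1 / p - 1 / r))) * h y) ∂μ ∂μ
        ≤ C * ((∫⁻ x, f x ^ p ∂μ) ^ (1 / p) * (∫⁻ y, h y ^ r ∂μ) ^ (1 / r)) := by
  obtain ⟨C, hC, H⟩ := exists_lintegral_riesz_le_of_le_one μ hp hr hpr
  refine ⟨C + 1, by finiteness, fun f h hf hh => ?_⟩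
  set l : ℝ := (finrank ℝ E : ℝ) * (2 - 1 / p - 1 / r) with hl
  have hp0 : 0 < p := by linarith
  have hr0 : 0 < r := by linarith
  have hzero : ∀ {g : E → ℝ≥0∞} {t : ℝ}, 0 < t → Measurable g → ∫⁻ x, g x ^ t ∂μ = 0 →
      g =ᵐ[μ] 0 := by
    intro g t ht hg h0
    rw [lintegral_eq_zero_iff (by fun_prop)] at h0
    filter_upwards [h0] with x hx
    simpa [ENNReal.rpow_eq_zero_iff, ht, ht.le, not_lt.2 ht.le] using hx
  have hnormal : ∀ {g : E → ℝ≥0∞} {t : ℝ}, 0 < t → ∫⁻ x, g x ^ t ∂μ ≠ 0 →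
      ∫⁻ x, g x ^ t ∂μ ≠ ⊤ →
      ∫⁻ x, (((∫⁻ x, g x ^ t ∂μ) ^ (1 / t))⁻¹ * g x) ^ t ∂μ ≤ 1 := by
    intro g t ht h0 h1
    have hne : (∫⁻ x, g x ^ t ∂μ) ^ (1 / t) ≠ 0 := by simp [h0, h1]
    simp_rw [ENNReal.mul_rpow_of_nonneg _ _ ht.le]
    rw [lintegral_const_mul' _ _
      (ENNReal.rpow_ne_top_of_nonneg ht.le (ENNReal.inv_ne_top.2 hne)),
      ENNReal.inv_rpow, ← ENNReal.rpow_mul, one_div_mul_cancel ht.ne', ENNReal.rpow_one,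
      ENNReal.inv_mul_cancel h0 h1]
  rcases eq_or_ne (∫⁻ x, f x ^ p ∂μ) 0 with hf0 | hf0
  · have : ∀ᵐ x ∂μ, ∫⁻ y, f x * (‖x - y‖ₑ ^ (-l) * h y) ∂μ = 0 := by
      filter_upwards [hzero hp0 hf hf0] with x hx
      simp [hx]
    rw [lintegral_congr_ae this]
    simp
  rcases eq_or_ne (∫⁻ y, h y ^ r ∂μ) 0 with hh0 | hh0
  · have : ∀ x, ∫⁻ y, f x * (‖x - y‖ₑ ^ (-l) * h y) ∂μ = 0 := by
      intro x
      rw [lintegral_eq_zero_iff (by fun_prop)]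
      filter_upwards [hzero hr0 hh hh0] with y hy
      simp [hy]
    simp [this]
  rcases eq_or_ne (∫⁻ x, f x ^ p ∂μ) ⊤ with hft | hft
  · rw [hft, ENNReal.top_rpow_of_pos (by positivity), ENNReal.top_mul, ENNReal.mul_top (by simp)]
    · exact le_top
    · simp [hh0, hr0.le]
  rcases eq_or_ne (∫⁻ y, h y ^ r ∂μ) ⊤ with hht | hht
  · rw [hht, ENNReal.top_rpow_of_pos (by positivity), ENNReal.mul_top, ENNReal.mul_top (by simp)]
    · exact le_top
    · simp [hf0, hp0.le]
  have key := H _ _ (hf.const_mul _) (hh.const_mul _) (hnormal hp0 hf0 hft) (hnormal hr0 hh0 hht)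
  set F := (∫⁻ x, f x ^ p ∂μ) ^ (1 / p) with hF
  set G := (∫⁻ y, h y ^ r ∂μ) ^ (1 / r) with hG
  have hF0 : F ≠ 0 := by simp [hF, hf0, hft]
  have hG0 : G ≠ 0 := by simp [hG, hh0, hht]
  have hFt : F ≠ ⊤ := ENNReal.rpow_ne_top_of_nonneg (by positivity) hft
  have hGt : G ≠ ⊤ := ENNReal.rpow_ne_top_of_nonneg (by positivity) hht
  have hFGt : F⁻¹ * G⁻¹ ≠ ⊤ := by finiteness
  have heq : ∫⁻ x, ∫⁻ y, F⁻¹ * f x * (‖x - y‖ₑ ^ (-l) * (G⁻¹ * h y)) ∂μ ∂μ =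
      F⁻¹ * G⁻¹ * ∫⁻ x, ∫⁻ y, f x * (‖x - y‖ₑ ^ (-l) * h y) ∂μ ∂μ := by
    rw [← lintegral_const_mul' _ _ hFGt]
    refine lintegral_congr fun x => ?_
    rw [← lintegral_const_mul' _ _ hFGt]
    refine lintegral_congr fun y => ?_
    ring
  rw [heq, ← ENNReal.mul_inv (Or.inl hF0) (Or.inl hFt),
    ENNReal.inv_mul_le_iff (mul_ne_zero hF0 hG0) (ENNReal.mul_ne_top hFt hGt)] at key
  refine key.trans ?_
  rw [mul_comm]
  exact mul_le_mul' le_self_add le_rfl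
end

/-- The bilinear inequality for the product of two Riesz kernels, by iteration. -/
theorem exists_lintegral_prod_riesz_le {E F : Type*} [NormedAddCommGroup E] [NormedSpace ℝ E]
    [FiniteDimensional ℝ E] [MeasurableSpace E] [BorelSpace E] [Nontrivial E]
    [NormedAddCommGroup F] [NormedSpace ℝ F] [FiniteDimensional ℝ F] [MeasurableSpace F]
    [BorelSpace F] [Nontrivial F] (μ : Measure E) [μ.IsAddHaarMeasure] (ν : Measure F)
    [ν.IsAddHaarMeasure] {p r : ℝ} (hp : 1 < p) (hr : 1 < r) (hpr : 1 < 1 / p + 1 / r) :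
    ∃ C : ℝ≥0∞, C ≠ ⊤ ∧ ∀ f h : E × F → ℝ≥0∞, Measurable f → Measurable h →
      ∫⁻ z, (∫⁻ w, f w * (‖z.1 - w.1‖ₑ ^ (-((finrank ℝ E : ℝ) * (2 - 1 / p - 1 / r))) *
          ‖z.2 - w.2‖ₑ ^ (-((finrank ℝ F : ℝ) * (2 - 1 / p - 1 / r)))) ∂(μ.prod ν)) * h z
          ∂(μ.prod ν)
        ≤ C * ((∫⁻ w, f w ^ p ∂(μ.prod ν)) ^ (1 / p) *
            (∫⁻ z, h z ^ r ∂(μ.prod ν)) ^ (1 / r)) := by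
  obtain ⟨C₁, hC₁, H₁⟩ := exists_lintegral_riesz_le μ hp hr hpr
  obtain ⟨C₂, hC₂, H₂⟩ := exists_lintegral_riesz_le ν hp hr hpr
  refine ⟨C₁ * C₂, by finiteness, fun f h hf hh => ?_⟩
  set a : ℝ := -((finrank ℝ E : ℝ) * (2 - 1 / p - 1 / r))
  set b : ℝ := -((finrank ℝ F : ℝ) * (2 - 1 / p - 1 / r))
  have hp0 : 0 < p := by linarith
  have hr0 : 0 < r := by linarith
  have hmp : Measurable fun x => (∫⁻ y, f (x, y) ^ p ∂ν) ^ (1 / p) :=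
    (Measurable.lintegral_prod_right' (f := fun z : E × F => f z ^ p) (by fun_prop)).pow_const _
  have hmr : Measurable fun x => (∫⁻ y, h (x, y) ^ r ∂ν) ^ (1 / r) :=
    (Measurable.lintegral_prod_right' (f := fun z : E × F => h z ^ r) (by fun_prop)).pow_const _
  have hint : ∀ {g : E × F → ℝ≥0∞} {t : ℝ}, 0 < t → Measurable g →
      ∫⁻ x, ((∫⁻ y, g (x, y) ^ t ∂ν) ^ (1 / t)) ^ t ∂μ = ∫⁻ z, g z ^ t ∂(μ.prod ν) := by
    intro g t ht hg
    rw [lintegral_prod _ (by fun_prop)]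
    simp_rw [← ENNReal.rpow_mul, one_div_mul_cancel ht.ne', ENNReal.rpow_one]
  calc _ = ∫⁻ w, ∫⁻ z, f w * (‖z.1 - w.1‖ₑ ^ a * ‖z.2 - w.2‖ₑ ^ b) * h z
        ∂(μ.prod ν) ∂(μ.prod ν) := by
        rw [lintegral_lintegral_swap (by fun_prop)]
        refine lintegral_congr fun z => ?_
        rw [lintegral_mul_const _ (by fun_prop)]
    _ = ∫⁻ x, ∫⁻ y, ∫⁻ u, ∫⁻ v, f (x, y) * (‖u - x‖ₑ ^ a * ‖v - y‖ₑ ^ b) * h (u, v)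
        ∂ν ∂μ ∂ν ∂μ := by
        rw [lintegral_prod]
        · refine lintegral_congr fun x => lintegral_congr fun y => ?_
          rw [lintegral_prod _ (by fun_prop)]
        · refine (Measurable.lintegral_prod_right' (f := fun t : (E × F) × (E × F) =>
            f t.1 * (‖t.2.1 - t.1.1‖ₑ ^ a * ‖t.2.2 - t.1.2‖ₑ ^ b) * h t.2) ?_).aemeasurable
          fun_prop
    _ = ∫⁻ x, ∫⁻ u, ∫⁻ y, ∫⁻ v, f (x, y) * (‖u - x‖ₑ ^ a * ‖v - y‖ₑ ^ b) * h (u, v)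
        ∂ν ∂ν ∂μ ∂μ := by
        refine lintegral_congr fun x => ?_
        rw [lintegral_lintegral_swap]
        refine (Measurable.lintegral_prod_right' (f := fun t : (F × E) × F =>
            f (x, t.1.1) * (‖t.1.2 - x‖ₑ ^ a * ‖t.2 - t.1.1‖ₑ ^ b) * h (t.1.2, t.2))
            ?_).aemeasurable
        fun_prop
    _ ≤ ∫⁻ x, ∫⁻ u, C₂ * ((∫⁻ y, f (x, y) ^ p ∂ν) ^ (1 / p) *
          (‖x - u‖ₑ ^ a * (∫⁻ v, h (u, v) ^ r ∂ν) ^ (1 / r))) ∂μ ∂μ := by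
        refine lintegral_mono fun x => lintegral_mono fun u => ?_
        have h1 := H₂ (fun y => f (x, y)) (fun v => h (u, v)) (by fun_prop) (by fun_prop)
        calc _ = ‖x - u‖ₑ ^ a * ∫⁻ y, ∫⁻ v, f (x, y) * (‖y - v‖ₑ ^ b * h (u, v)) ∂ν ∂ν := by
              rw [← lintegral_const_mul]
              · refine lintegral_congr fun y => ?_
                rw [← lintegral_const_mul _ (by fun_prop)]
                refine lintegral_congr fun v => ?_
                rw [← enorm_neg (u - x), ← enorm_neg (v - y), neg_sub, neg_sub]
                ring
              · refine Measurable.lintegral_prod_right' (f := fun t : F × F =>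
                  f (x, t.1) * (‖t.1 - t.2‖ₑ ^ b * h (u, t.2))) ?_
                fun_prop
          _ ≤ _ := mul_le_mul' le_rfl h1
          _ = _ := by ring
    _ = C₂ * ∫⁻ x, ∫⁻ u, (∫⁻ y, f (x, y) ^ p ∂ν) ^ (1 / p) *
          (‖x - u‖ₑ ^ a * (∫⁻ v, h (u, v) ^ r ∂ν) ^ (1 / r)) ∂μ ∂μ := by
        rw [← lintegral_const_mul' _ _ hC₂]
        refine lintegral_congr fun x => ?_
        rw [lintegral_const_mul' _ _ hC₂]
    _ ≤ C₂ * (C₁ * ((∫⁻ w, f w ^ p ∂(μ.prod ν)) ^ (1 / p) *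
            (∫⁻ z, h z ^ r ∂(μ.prod ν)) ^ (1 / r))) := by
        have h1 := H₁ _ _ hmp hmr
        rw [hint hp0 hf, hint hr0 hh] at h1
        exact mul_le_mul' le_rfl h1
    _ = _ := by ring

/-- The `L^q` norm is controlled by testing against the dual space. -/
theorem lintegral_rpow_le_of_forall_lintegral_mul_le {X : Type*} [MeasurableSpace X]
    {μ : Measure X} [SigmaFinite μ] {q r : ℝ} (hqr : q.HolderConjugate r) {g : X → ℝ≥0∞}
    (hg : Measurable g) {M : ℝ≥0∞}
    (H : ∀ h : X → ℝ≥0∞, Measurable h → ∫⁻ x, g x * h x ∂μ ≤ M * (∫⁻ x, h x ^ r ∂μ) ^ (1 / r)) :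
    (∫⁻ x, g x ^ q ∂μ) ^ (1 / q) ≤ M := by
  have hq0 : 0 < q := hqr.pos
  have hq1 : 0 < q - 1 := hqr.sub_one_pos
  set G : ℕ → X → ℝ≥0∞ := fun N => (spanningSets μ N).indicator fun x => min (g x) N with hG
  have hGm : ∀ N, Measurable (G N) := fun N =>
    (hg.min measurable_const).indicator (measurableSet_spanningSets μ N)
  have hGg : ∀ N x, G N x ≤ g x := fun N x =>
    (indicator_le_self _ _ x).trans (min_le_left _ _)
  have hGmono : ∀ x, Monotone fun N => G N x := by
    intro x N N' hNN'
    have h1 : min (g x) N ≤ min (g x) N' := min_le_min_left _ (Nat.cast_le.2 hNN')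
    exact (indicator_le_indicator h1).trans
      (indicator_le_indicator_apply_of_subset (monotone_spanningSets μ hNN') zero_le)
  have hGfin : ∀ N, ∫⁻ x, G N x ^ q ∂μ ≠ ⊤ := by
    intro N
    have : ∫⁻ x, G N x ^ q ∂μ ≤ ∫⁻ x in spanningSets μ N, (N : ℝ≥0∞) ^ q ∂μ := by
      rw [← lintegral_indicator (measurableSet_spanningSets μ N)]
      refine lintegral_mono fun x => ?_
      by_cases hx : x ∈ spanningSets μ N
      · simp only [hG, indicator_of_mem hx]
        gcongr
        exact min_le_right _ _
      · simp [hG, indicator_of_notMem hx, hq0]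
    refine (this.trans_lt ?_).ne
    rw [setLIntegral_const]
    exact ENNReal.mul_lt_top (ENNReal.rpow_lt_top_of_nonneg hq0.le (ENNReal.natCast_ne_top N))
      (measure_spanningSets_lt_top μ N)
  have hGM : ∀ N, ∫⁻ x, G N x ^ q ∂μ ≤ M ^ q := by
    intro N
    have hJ := H (fun x => G N x ^ (q - 1)) ((hGm N).pow_const _)
    simp_rw [← ENNReal.rpow_mul, hqr.sub_one_mul_conj] at hJ
    have hle : ∫⁻ x, G N x ^ q ∂μ ≤ ∫⁻ x, g x * G N x ^ (q - 1) ∂μ := by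
      refine lintegral_mono fun x => ?_
      calc G N x ^ q = G N x * G N x ^ (q - 1) := by
            nth_rewrite 2 [← ENNReal.rpow_one (G N x)]
            rw [← ENNReal.rpow_add_of_nonneg _ _ zero_le_one hq1.le]
            congr 1; ring
        _ ≤ _ := mul_le_mul' (hGg N x) le_rfl
    rcases eq_or_ne (∫⁻ x, G N x ^ q ∂μ) 0 with h0 | h0
    · rw [h0]; exact zero_le
    have h2 := ENNReal.div_le_of_le_mul (hle.trans hJ)
    nth_rewrite 1 [← ENNReal.rpow_one (∫⁻ x, G N x ^ q ∂μ)] at h2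
    rw [← ENNReal.rpow_sub _ _ h0 (hGfin N),
      show 1 - 1 / r = q⁻¹ by rw [one_div, hqr.symm.one_sub_inv]] at h2
    have := ENNReal.rpow_le_rpow h2 hq0.le
    rwa [ENNReal.rpow_inv_rpow hq0.ne'] at this
  have hlim : Filter.Tendsto (fun N => ∫⁻ x, G N x ^ q ∂μ) Filter.atTop
      (nhds (∫⁻ x, g x ^ q ∂μ)) := by
    refine lintegral_tendsto_of_tendsto_of_monotone (fun N => ((hGm N).pow_const _).aemeasurable)
      (.of_forall fun x N N' hN => ENNReal.rpow_le_rpow (hGmono x hN) hq0.le)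
      (.of_forall fun x => ?_)
    refine (ENNReal.continuous_rpow_const.tendsto _).comp ?_
    have h1 : Filter.Tendsto (fun N : ℕ => min (g x) N) Filter.atTop (nhds (g x)) := by
      simpa using (tendsto_const_nhds (x := g x)).min ENNReal.tendsto_nat_nhds_top
    refine h1.congr' ?_
    filter_upwards [Filter.eventually_ge_atTop (spanningSetsIndex μ x)] with N hN
    have : x ∈ spanningSets μ N := mem_spanningSets_of_index_le μ x hN
    simp only [hG, indicator_of_mem this]
  have := le_of_tendsto' hlim hGM
  rw [one_div]
  exact (ENNReal.rpow_inv_le_iff hq0).2 this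

/-- The flag kernel is dominated by a product of Riesz kernels of the same homogeneity. -/
theorem enorm_flagKernel_le {n m : ℕ} {α β ρ s : ℝ} (hαn : α < n) (hm : 0 < m) (hs : s < 1)
    (hβs : β ≤ m * s) (hhom : α + ρ * β = s * (n + ρ * m))
    (x : EuclideanSpace ℝ (Fin n)) (y : EuclideanSpace ℝ (Fin m)) :
    ‖flagKernel n m α β ρ x y‖ₑ ≤
      ‖x‖ₑ ^ (-((n : ℝ) * (1 - s))) * ‖y‖ₑ ^ (-((m : ℝ) * (1 - s))) := by
  have hm' : (0 : ℝ) < m := by exact_mod_cast hm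
  have hms : 0 < (m : ℝ) * (1 - s) := mul_pos hm' (by linarith)
  rcases eq_or_ne x 0 with rfl | hx
  · simp [flagKernel, Real.zero_rpow (by linarith : α - n ≠ 0)]
  rcases eq_or_ne y 0 with rfl | hy
  · rw [enorm_zero, ENNReal.zero_rpow_of_neg (by linarith), ENNReal.mul_top]
    · exact le_top
    · exact (ENNReal.rpow_pos (by simpa using hx) enorm_ne_top).ne'
  have ha : 0 < ‖x‖ := norm_pos_iff.2 hx
  have hb : 0 < ‖y‖ := norm_pos_iff.2 hy
  have hK : 0 ≤ flagKernel n m α β ρ x y := by unfold flagKernel; positivity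
  rw [Real.enorm_of_nonneg hK, ← ofReal_norm, ← ofReal_norm, ENNReal.ofReal_rpow_of_pos ha,
    ENNReal.ofReal_rpow_of_pos hb, ← ENNReal.ofReal_mul (by positivity)]
  refine ENNReal.ofReal_le_ofReal ?_
  unfold flagKernel
  have haρ : 0 < ‖x‖ ^ ρ := by positivity
  calc ‖x‖ ^ (α - n) * (‖x‖ ^ ρ + ‖y‖) ^ (β - m)
      = ‖x‖ ^ (α - n) * ((‖x‖ ^ ρ + ‖y‖) ^ (β - m * s) *
          (‖x‖ ^ ρ + ‖y‖) ^ (-((m : ℝ) * (1 - s)))) := by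
        rw [← Real.rpow_add (by positivity)]
        congr 2; ring
    _ ≤ ‖x‖ ^ (α - n) * ((‖x‖ ^ ρ) ^ (β - m * s) * ‖y‖ ^ (-((m : ℝ) * (1 - s)))) := by
        refine mul_le_mul_of_nonneg_left ?_ (by positivity)
        refine mul_le_mul ?_ ?_ (by positivity) (by positivity)
        · exact Real.rpow_le_rpow_of_nonpos haρ (by linarith) (by linarith)
        · exact Real.rpow_le_rpow_of_nonpos hb (by linarith) (by linarith)
    _ = ‖x‖ ^ (-((n : ℝ) * (1 - s))) * ‖y‖ ^ (-((m : ℝ) * (1 - s))) := by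
        rw [← mul_assoc, ← Real.rpow_mul ha.le, ← Real.rpow_add ha]
        congr 2
        linarith

/-- Sufficiency in Theorem One: if `α/n ≥ β/m` and `(α+ρβ)/(n+ρm) = 1/p - 1/q`,
then `I` is bounded from `L^p(ℝ^{n+m})` to `L^q(ℝ^{n+m})`. -/
theorem flagOp_Lp_Lq_bound (n m : ℕ) (hn : 0 < n) (hm : 0 < m) (α β ρ p q : ℝ)
    (hα : 0 < α) (hαn : α < n) (hβ : 0 < β) (hβm : β < m) (hρ : 1 ≤ ρ)
    (hp : 1 < p) (hpq : p < q)
    (hmain : β / m ≤ α / n)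
    (hhom : (α + ρ * β) / (n + ρ * m) = 1 / p - 1 / q) :
    ∃ C : ℝ, 0 < C ∧
      ∀ f : EuclideanSpace ℝ (Fin n) × EuclideanSpace ℝ (Fin m) → ℝ,
        Measurable f → (∀ w, 0 ≤ f w) →
        eLpNorm (flagOp n m α β ρ f) (ENNReal.ofReal q) volume ≤
          ENNReal.ofReal C * eLpNorm f (ENNReal.ofReal p) volume := by
  have hn' : (0 : ℝ) < n := by exact_mod_cast hn
  have hm' : (0 : ℝ) < m := by exact_mod_cast hm
  have hp0 : 0 < p := by linarith
  have hq0 : 0 < q := by linarith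
  have hqr : q.HolderConjugate (q / (q - 1)) := Real.HolderConjugate.conjExponent (by linarith)
  set r : ℝ := q / (q - 1)
  have hri : 1 / r = 1 - 1 / q := by rw [one_div, one_div, hqr.one_sub_inv]
  set s : ℝ := 1 / p - 1 / q with hs
  have hp1 : 1 / p < 1 := by rw [div_lt_one hp0]; exact hp
  have hqi : 0 < 1 / q := by positivity
  have hs0 : 0 < s := by rw [← hhom]; positivity
  have hs1 : s < 1 := by linarith
  have hhom' : α + ρ * β = s * (n + ρ * m) := by
    rw [div_eq_iff (by positivity)] at hhom; exact hhom
  have hβs : β ≤ m * s := by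
    rw [div_le_div_iff₀ hm' hn'] at hmain
    have h1 : β * (n + ρ * m) ≤ m * s * (n + ρ * m) := by nlinarith
    exact le_of_mul_le_mul_right h1 (by positivity)
  have : Nontrivial (EuclideanSpace ℝ (Fin n)) :=
    Module.nontrivial_of_finrank_pos (R := ℝ) (by simpa using hn)
  have : Nontrivial (EuclideanSpace ℝ (Fin m)) :=
    Module.nontrivial_of_finrank_pos (R := ℝ) (by simpa using hm)
  obtain ⟨C, hC, H⟩ := exists_lintegral_prod_riesz_le
    (volume : Measure (EuclideanSpace ℝ (Fin n))) (volume : Measure (EuclideanSpace ℝ (Fin m)))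
    hp hqr.symm.lt (by linarith)
  rw [show (2 : ℝ) - 1 / p - 1 / r = 1 - s by rw [hri, hs]; ring, finrank_euclideanSpace_fin,
    finrank_euclideanSpace_fin, ← Measure.volume_eq_prod] at H
  refine ⟨C.toReal + 1, by positivity, fun f hf _ => ?_⟩
  set k : EuclideanSpace ℝ (Fin n) × EuclideanSpace ℝ (Fin m) → ℝ≥0∞ :=
    fun z => ‖z.1‖ₑ ^ (-((n : ℝ) * (1 - s))) * ‖z.2‖ₑ ^ (-((m : ℝ) * (1 - s))) with hk
  set g : EuclideanSpace ℝ (Fin n) × EuclideanSpace ℝ (Fin m) → ℝ≥0∞ :=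
    fun z => ∫⁻ w, ‖f w‖ₑ * k (z - w) with hg
  have hgm : Measurable g := by
    refine Measurable.lintegral_prod_right'
      (f := fun t : (EuclideanSpace ℝ (Fin n) × EuclideanSpace ℝ (Fin m)) ×
        (EuclideanSpace ℝ (Fin n) × EuclideanSpace ℝ (Fin m)) => ‖f t.2‖ₑ * k (t.1 - t.2)) ?_
    fun_prop
  have hfg : ∀ z, ‖flagOp n m α β ρ f z‖ₑ ≤ g z := by
    intro z
    refine (enorm_integral_le_lintegral_enorm _).trans (lintegral_mono fun w => ?_)
    rw [enorm_mul]
    exact mul_le_mul' le_rfl (enorm_flagKernel_le hαn hm hs1 hβs hhom' _ _)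
  have hbound : (∫⁻ z, g z ^ q) ^ (1 / q) ≤ C * (∫⁻ w, ‖f w‖ₑ ^ p) ^ (1 / p) := by
    refine lintegral_rpow_le_of_forall_lintegral_mul_le hqr hgm fun h hh => ?_
    rw [mul_assoc]
    exact H (fun w => ‖f w‖ₑ) h hf.enorm hh
  rw [eLpNorm_eq_lintegral_rpow_enorm_toReal (by simpa using hq0) ENNReal.ofReal_ne_top,
    eLpNorm_eq_lintegral_rpow_enorm_toReal (by simpa using hp0) ENNReal.ofReal_ne_top,
    ENNReal.toReal_ofReal hq0.le, ENNReal.toReal_ofReal hp0.le]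
  calc _ ≤ (∫⁻ z, g z ^ q) ^ (1 / q) := by
        gcongr with z
        exact hfg z
    _ ≤ _ := hbound
    _ ≤ _ := by
        gcongr
        exact (ENNReal.ofReal_toReal hC).ge.trans (ENNReal.ofReal_le_ofReal (by linarith))
end

section
/- Let 0 < q < ∞, let f be a nonnegative measurable function on ℝ^n × ℝ^m, and for δ > 0 and λ ≥ 1 define f_{δ,λ}(x,y) = f(δ^{−1} x, δ^{−ρ} λ^{−1} y). Then ‖I f_{δ,λ}‖_{L^q(ℝ^{n+m})} ≥ δ^{α+ρβ+(n+ρm)/q} · λ^{β+m/q} · ‖I f‖_{L^q(ℝ^{n+m})}. -/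
open MeasureTheory

/-- The anisotropic dilation `(x, y) ↦ (a x, b y)` is a measurable embedding. -/
theorem measurableEmbedding_prodMap_smul {E F : Type*}
    [NormedAddCommGroup E] [NormedSpace ℝ E] [MeasurableSpace E] [BorelSpace E]
    [NormedAddCommGroup F] [NormedSpace ℝ F] [MeasurableSpace F] [BorelSpace F]
    {a b : ℝ} (ha : a ≠ 0) (hb : b ≠ 0) :
    MeasurableEmbedding (Prod.map (a • · : E → E) (b • · : F → F)) :=
  ((Homeomorph.smulOfNeZero a ha).toMeasurableEquiv.prodCongr
    (Homeomorph.smulOfNeZero b hb).toMeasurableEquiv).measurableEmbedding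

/-- The image of Lebesgue measure under an anisotropic dilation. -/
theorem map_prodMap_smul_volume (n m : ℕ) {a b : ℝ} (ha : 0 < a) (hb : 0 < b) :
    Measure.map (Prod.map (a • · : EuclideanSpace ℝ (Fin n) → EuclideanSpace ℝ (Fin n))
      (b • · : EuclideanSpace ℝ (Fin m) → EuclideanSpace ℝ (Fin m))) volume =
      ENNReal.ofReal ((a ^ n * b ^ m)⁻¹) • volume := by
  rw [Measure.volume_eq_prod, ← Measure.map_prod_map _ _ (by fun_prop) (by fun_prop),
    Measure.map_addHaar_smul _ ha.ne', Measure.map_addHaar_smul _ hb.ne',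
    Measure.prod_smul_left, Measure.prod_smul_right, smul_smul,
    finrank_euclideanSpace_fin, finrank_euclideanSpace_fin,
    abs_of_pos (by positivity), abs_of_pos (by positivity),
    ← ENNReal.ofReal_mul (by positivity), mul_inv]

theorem flagKernel_nonneg (n m : ℕ) (α β ρ : ℝ)
    (x : EuclideanSpace ℝ (Fin n)) (y : EuclideanSpace ℝ (Fin m)) :
    0 ≤ flagKernel n m α β ρ x y := by
  unfold flagKernel
  positivity

theorem Measurable.flagKernel {X : Type*} [MeasurableSpace X] {n m : ℕ} (α β ρ : ℝ)
    {g : X → EuclideanSpace ℝ (Fin n)} {h : X → EuclideanSpace ℝ (Fin m)}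
    (hg : Measurable g) (hh : Measurable h) :
    Measurable fun w => flagKernel n m α β ρ (g w) (h w) := by
  unfold _root_.flagKernel
  fun_prop

theorem flagKernel_dilation (n m : ℕ) (α β ρ : ℝ) {δ : ℝ} (l : ℝ) (hδ : 0 < δ) (hl : 0 ≤ l)
    (x : EuclideanSpace ℝ (Fin n)) (y : EuclideanSpace ℝ (Fin m)) :
    flagKernel n m α β ρ (δ • x) ((δ ^ ρ * l) • y) =
      δ ^ (α - n) * (δ ^ ρ) ^ (β - m) *
        (‖x‖ ^ (α - (n : ℝ)) * (‖x‖ ^ ρ + l * ‖y‖) ^ (β - (m : ℝ))) := by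
  have hδρ : 0 < δ ^ ρ := Real.rpow_pos_of_pos hδ ρ
  unfold flagKernel
  rw [norm_smul, norm_smul, Real.norm_of_nonneg hδ.le,
    Real.norm_of_nonneg (mul_nonneg hδρ.le hl), Real.mul_rpow hδ.le (norm_nonneg x),
    Real.mul_rpow hδ.le (norm_nonneg x), mul_assoc (δ ^ ρ), ← mul_add,
    Real.mul_rpow hδρ.le (by positivity)]
  ring

/-- For `l ≥ 1` the partial dilation changes the second factor of the flag kernel by at most a
factor between `l ^ s` and `1`, where `s < 0` is the exponent. -/
theorem rpow_add_mul_bounds {A B l s : ℝ} (hA : 0 ≤ A) (hB : 0 ≤ B) (hl : 1 ≤ l) (hs : s < 0) :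
    l ^ s * (A + B) ^ s ≤ (A + l * B) ^ s ∧ (A + l * B) ^ s ≤ (A + B) ^ s := by
  have hl0 : 0 < l := zero_lt_one.trans_le hl
  rcases (add_nonneg hA hB).eq_or_lt' with h | h
  · obtain ⟨rfl, rfl⟩ := (add_eq_zero_iff_of_nonneg hA hB).1 h
    simp [Real.zero_rpow hs.ne]
  · have h1 : A + B ≤ A + l * B := by nlinarith
    refine ⟨?_, Real.rpow_le_rpow_of_nonpos h h1 hs.le⟩
    rw [← Real.mul_rpow hl0.le h.le]
    exact Real.rpow_le_rpow_of_nonpos (h.trans_le h1) (by nlinarith) hs.le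

theorem flagKernel_dilation_bounds (n m : ℕ) (α β ρ : ℝ) (hβm : β < m) {δ l : ℝ}
    (hδ : 0 < δ) (hl : 1 ≤ l)
    (x : EuclideanSpace ℝ (Fin n)) (y : EuclideanSpace ℝ (Fin m)) :
    δ ^ (α - n) * (δ ^ ρ) ^ (β - m) * l ^ (β - m) * flagKernel n m α β ρ x y ≤
        flagKernel n m α β ρ (δ • x) ((δ ^ ρ * l) • y) ∧
      flagKernel n m α β ρ (δ • x) ((δ ^ ρ * l) • y) ≤
        δ ^ (α - n) * (δ ^ ρ) ^ (β - m) * flagKernel n m α β ρ x y := by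
  obtain ⟨h1, h2⟩ := rpow_add_mul_bounds (Real.rpow_nonneg (norm_nonneg x) ρ) (norm_nonneg y) hl
    (sub_neg.2 hβm)
  rw [flagKernel_dilation n m α β ρ l hδ (zero_le_one.trans hl), mul_assoc _ (l ^ (β - m))]
  unfold flagKernel
  rw [mul_left_comm (l ^ (β - m))]
  constructor <;> gcongr

/-- A change of variables in the flag operator applied to a dilated function. -/
theorem flagOp_dilation (n m : ℕ) (α β ρ : ℝ)
    (f : EuclideanSpace ℝ (Fin n) × EuclideanSpace ℝ (Fin m) → ℝ)
    {a b : ℝ} (ha : 0 < a) (hb : 0 < b)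
    (z : EuclideanSpace ℝ (Fin n) × EuclideanSpace ℝ (Fin m)) :
    flagOp n m α β ρ (fun w => f (a⁻¹ • w.1, b⁻¹ • w.2)) (Prod.map (a • ·) (b • ·) z) =
      a ^ n * b ^ m *
        ∫ w, f w * flagKernel n m α β ρ (a • (z.1 - w.1)) (b • (z.2 - w.2)) := by
  have h := (measurableEmbedding_prodMap_smul (E := EuclideanSpace ℝ (Fin n))
    (F := EuclideanSpace ℝ (Fin m)) ha.ne' hb.ne').integral_map (μ := volume)
    fun w => f (a⁻¹ • w.1, b⁻¹ • w.2) *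
      flagKernel n m α β ρ (a • z.1 - w.1) (b • z.2 - w.2)
  rw [map_prodMap_smul_volume n m ha hb, integral_smul_measure,
    ENNReal.toReal_ofReal (by positivity), smul_eq_mul, inv_mul_eq_iff_eq_mul₀ (by positivity)] at h
  simpa only [flagOp, Prod.map_fst, Prod.map_snd, inv_smul_smul₀ ha.ne', inv_smul_smul₀ hb.ne',
    smul_sub, Prod.mk.eta] using h

theorem flagOp_nonneg (n m : ℕ) (α β ρ : ℝ)
    {f : EuclideanSpace ℝ (Fin n) × EuclideanSpace ℝ (Fin m) → ℝ} (hf0 : ∀ w, 0 ≤ f w)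
    (z : EuclideanSpace ℝ (Fin n) × EuclideanSpace ℝ (Fin m)) :
    0 ≤ flagOp n m α β ρ f z :=
  integral_nonneg fun w => mul_nonneg (hf0 w) (flagKernel_nonneg ..)

theorem flagOp_dilation_pointwise_lower_bound (n m : ℕ) (α β ρ : ℝ) (hβm : β < m)
    {f : EuclideanSpace ℝ (Fin n) × EuclideanSpace ℝ (Fin m) → ℝ}
    (hf : Measurable f) (hf0 : ∀ w, 0 ≤ f w) {δ l : ℝ} (hδ : 0 < δ) (hl : 1 ≤ l)
    (z : EuclideanSpace ℝ (Fin n) × EuclideanSpace ℝ (Fin m)) :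
    δ ^ (α + ρ * β) * l ^ β * flagOp n m α β ρ f z ≤
      flagOp n m α β ρ (fun w => f (δ⁻¹ • w.1, (δ ^ ρ * l)⁻¹ • w.2))
        (Prod.map (δ • ·) ((δ ^ ρ * l) • ·) z) := by
  have hl0 : 0 < l := zero_lt_one.trans_le hl
  have hδρ : 0 < δ ^ ρ := Real.rpow_pos_of_pos hδ ρ
  have hK (w : EuclideanSpace ℝ (Fin n) × EuclideanSpace ℝ (Fin m)) :=
    flagKernel_dilation_bounds n m α β ρ hβm hδ hl (z.1 - w.1) (z.2 - w.2)
  by_cases hint : Integrable fun w => f w * flagKernel n m α β ρ (z.1 - w.1) (z.2 - w.2)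
  · have hmeas : Measurable fun w => f w *
        flagKernel n m α β ρ (δ • (z.1 - w.1)) ((δ ^ ρ * l) • (z.2 - w.2)) :=
      hf.mul (.flagKernel α β ρ (by fun_prop) (by fun_prop))
    have hint' : Integrable fun w => f w *
        flagKernel n m α β ρ (δ • (z.1 - w.1)) ((δ ^ ρ * l) • (z.2 - w.2)) := by
      refine (hint.const_mul (δ ^ (α - n) * (δ ^ ρ) ^ (β - m))).mono'
        hmeas.aestronglyMeasurable (.of_forall fun w => ?_)
      rw [Real.norm_of_nonneg (mul_nonneg (hf0 w) (flagKernel_nonneg ..)), mul_left_comm]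
      exact mul_le_mul_of_nonneg_left (hK w).2 (hf0 w)
    have hle := integral_mono
      (hint.const_mul (δ ^ (α - n) * (δ ^ ρ) ^ (β - m) * l ^ (β - m))) hint' fun w =>
        (mul_left_comm _ _ _).trans_le (mul_le_mul_of_nonneg_left (hK w).1 (hf0 w))
    rw [integral_const_mul] at hle
    rw [flagOp_dilation n m α β ρ f hδ (mul_pos hδρ hl0)]
    refine le_trans (le_of_eq ?_) (mul_le_mul_of_nonneg_left hle (by positivity))
    rw [flagOp, ← mul_assoc]
    congr 1
    rw [Real.rpow_sub hδ, Real.rpow_sub hδρ, Real.rpow_sub hl0, Real.rpow_natCast,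
      Real.rpow_natCast, Real.rpow_natCast, Real.rpow_add hδ, Real.rpow_mul hδ.le]
    field_simp
    rw [mul_pow]
  · have h0 : flagOp n m α β ρ f z = 0 := integral_undef hint
    rw [h0, mul_zero]
    exact flagOp_nonneg n m α β ρ (fun _ => hf0 _) _

/-- Scaling of the `L^q` norm under anisotropic dilations, for arbitrary functions. -/
theorem eLpNorm_comp_prodMap_smul (n m : ℕ) {a b q : ℝ} (ha : 0 < a) (hb : 0 < b) (hq : 0 < q)
    (g : EuclideanSpace ℝ (Fin n) × EuclideanSpace ℝ (Fin m) → ℝ) :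
    ENNReal.ofReal ((a ^ n * b ^ m) ^ (1 / q)) *
        eLpNorm (g ∘ Prod.map (a • ·) (b • ·)) (ENNReal.ofReal q) volume =
      eLpNorm g (ENNReal.ofReal q) volume := by
  rw [← (measurableEmbedding_prodMap_smul ha.ne' hb.ne').eLpNorm_map_measure,
    map_prodMap_smul_volume n m ha hb,
    eLpNorm_smul_measure_of_ne_top ENNReal.ofReal_ne_top, smul_eq_mul, ← mul_assoc,
    ENNReal.toReal_div, ENNReal.toReal_one, ENNReal.toReal_ofReal hq.le,
    ENNReal.ofReal_rpow_of_pos (by positivity),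
    ← ENNReal.ofReal_mul (by positivity), ← Real.mul_rpow (by positivity) (by positivity),
    mul_inv_cancel₀ (by positivity), Real.one_rpow, ENNReal.ofReal_one, one_mul]

/-- The dilation estimate: for `f ≥ 0`, `δ > 0`, `λ ≥ 1` and
`f_{δ,λ}(x,y) = f(δ⁻¹ x, δ^{-ρ} λ⁻¹ y)`, one has
`‖I f_{δ,λ}‖_{L^q} ≥ δ^{α+ρβ+(n+ρm)/q} λ^{β+m/q} ‖I f‖_{L^q}`. -/
theorem flagOp_dilation_lower_bound (n m : ℕ) (hn : 0 < n) (hm : 0 < m) (α β ρ q : ℝ)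
    (hα : 0 < α) (hαn : α < n) (hβ : 0 < β) (hβm : β < m) (hρ : 1 ≤ ρ)
    (hq : 0 < q)
    (f : EuclideanSpace ℝ (Fin n) × EuclideanSpace ℝ (Fin m) → ℝ)
    (hf : Measurable f) (hf0 : ∀ w, 0 ≤ f w)
    (δ l : ℝ) (hδ : 0 < δ) (hl : 1 ≤ l) :
    ENNReal.ofReal (δ ^ (α + ρ * β + (n + ρ * m) / q) * l ^ (β + m / q)) *
        eLpNorm (flagOp n m α β ρ f) (ENNReal.ofReal q) volume ≤
      eLpNorm
        (flagOp n m α β ρ (fun w => f (δ⁻¹ • w.1, (δ ^ ρ * l)⁻¹ • w.2)))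
        (ENNReal.ofReal q) volume := by
  have hl0 : 0 < l := zero_lt_one.trans_le hl
  have hδρ : 0 < δ ^ ρ := Real.rpow_pos_of_pos hδ ρ
  have hpow : δ ^ (α + ρ * β + (n + ρ * m) / q) * l ^ (β + m / q) =
      (δ ^ n * (δ ^ ρ * l) ^ m) ^ (1 / q) * (δ ^ (α + ρ * β) * l ^ β) := by
    rw [← Real.rpow_natCast δ n, ← Real.rpow_natCast (δ ^ ρ * l) m, Real.mul_rpow hδρ.le hl0.le,
      ← Real.rpow_mul hδ.le, ← mul_assoc (δ ^ (n : ℝ)), ← Real.rpow_add hδ,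
      Real.mul_rpow (by positivity) (by positivity), ← Real.rpow_mul hδ.le,
      ← Real.rpow_mul hl0.le, Real.rpow_add hδ, Real.rpow_add hl0, mul_one_div, mul_one_div]
    ring
  rw [hpow, ENNReal.ofReal_mul (by positivity), mul_assoc,
    ← eLpNorm_comp_prodMap_smul n m hδ (mul_pos hδρ hl0) hq
      (flagOp n m α β ρ fun w => f (δ⁻¹ • w.1, (δ ^ ρ * l)⁻¹ • w.2))]
  refine mul_le_mul_right ?_ _
  rw [← Real.enorm_of_nonneg (by positivity : 0 ≤ δ ^ (α + ρ * β) * l ^ β),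
    ← eLpNorm_const_smul]
  refine eLpNorm_mono_real fun z => ?_
  rw [Pi.smul_apply, smul_eq_mul, Real.norm_of_nonneg
    (mul_nonneg (by positivity) (flagOp_nonneg n m α β ρ hf0 z))]
  exact flagOp_dilation_pointwise_lower_bound n m α β ρ hβm hf hf0 hδ hl z
end

section
/- Assume α·m ≥ β·n, and define a = n(α+ρβ)/(n+ρm) and b = m(α+ρβ)/(n+ρm). Then for all x ∈ ℝ^n with x ≠ 0 and all y ∈ ℝ^m with y ≠ 0, Ω(x,y) ≤ |x|^{a−n}·(|x|^ρ + |y|)^{b−m} ≤ |x|^{a−n}·|y|^{b−m}. -/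
open MeasureTheory

/-- If `c - p = ρ * (q - d)` with `d ≤ q`, then, for positive `r` and nonnegative `s`, part of the
power of `r` in `r ^ c * (r ^ ρ + s) ^ d` can be absorbed by the factor `r ^ ρ + s`. -/
theorem rpow_mul_add_rpow_le_of_sub_eq {r s c d p q ρ : ℝ} (hr : 0 < r) (hs : 0 ≤ s)
    (hdq : d ≤ q) (h : c - p = ρ * (q - d)) :
    r ^ c * (r ^ ρ + s) ^ d ≤ r ^ p * (r ^ ρ + s) ^ q := by
  have hrρ : 0 < r ^ ρ := Real.rpow_pos_of_pos hr ρ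
  have hS : 0 < r ^ ρ + s := by positivity
  have hc : r ^ c = r ^ p * (r ^ ρ) ^ (q - d) := by
    rw [← Real.rpow_mul hr.le, ← Real.rpow_add hr, ← h, add_sub_cancel]
  have hq : (r ^ ρ + s) ^ q = (r ^ ρ + s) ^ (q - d) * (r ^ ρ + s) ^ d := by
    rw [← Real.rpow_add hS, sub_add_cancel]
  rw [hc, hq, mul_assoc]
  have hle : (r ^ ρ) ^ (q - d) ≤ (r ^ ρ + s) ^ (q - d) :=
    Real.rpow_le_rpow hrρ.le (by linarith) (by linarith)
  gcongr

/-- Kernel domination: with `a = n(α+ρβ)/(n+ρm)` and `b = m(α+ρβ)/(n+ρm)`, one has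
`Ω(x,y) ≤ |x|^{a-n} (|x|^ρ+|y|)^{b-m} ≤ |x|^{a-n} |y|^{b-m}` for `x ≠ 0`, `y ≠ 0`. -/
theorem flagKernel_dominated (n m : ℕ) (hn : 0 < n) (hm : 0 < m) (α β ρ : ℝ)
    (hα : 0 < α) (hαn : α < n) (hβ : 0 < β) (hβm : β < m) (hρ : 1 ≤ ρ)
    (hab : β * n ≤ α * m) (a b : ℝ)
    (ha : a = n * (α + ρ * β) / (n + ρ * m))
    (hb : b = m * (α + ρ * β) / (n + ρ * m)) :
    ∀ (x : EuclideanSpace ℝ (Fin n)) (y : EuclideanSpace ℝ (Fin m)),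
      x ≠ 0 → y ≠ 0 →
      flagKernel n m α β ρ x y ≤ ‖x‖ ^ (a - (n : ℝ)) * (‖x‖ ^ ρ + ‖y‖) ^ (b - (m : ℝ)) ∧
      ‖x‖ ^ (a - (n : ℝ)) * (‖x‖ ^ ρ + ‖y‖) ^ (b - (m : ℝ)) ≤
        ‖x‖ ^ (a - (n : ℝ)) * ‖y‖ ^ (b - (m : ℝ)) := by
  intro x y hx hy
  have hx' : 0 < ‖x‖ := norm_pos_iff.mpr hx
  have hy' : 0 < ‖y‖ := norm_pos_iff.mpr hy
  have hn' : (0 : ℝ) < n := Nat.cast_pos.mpr hn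
  have hm' : (0 : ℝ) < m := Nat.cast_pos.mpr hm
  have hρ' : 0 < ρ := by linarith
  have hD : (0 : ℝ) < n + ρ * m := by positivity
  have hbβ : b - β = (α * m - β * n) / (n + ρ * m) := by
    rw [hb]; field_simp; ring
  have hαa : α - a = ρ * (b - β) := by
    rw [ha, hbβ]; field_simp; ring
  have hβb : 0 ≤ b - β := by
    rw [hbβ]; exact div_nonneg (by linarith) hD.le
  have hbm : b ≤ m := by
    rw [hb, div_le_iff₀ hD]
    gcongr
  refine ⟨rpow_mul_add_rpow_le_of_sub_eq hx' hy'.le (by linarith) (by linear_combination hαa), ?_⟩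
  gcongr ?_ * ?_
  exact Real.rpow_le_rpow_of_nonpos hy' (le_add_of_nonneg_left (by positivity)) (by linarith)
end
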